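/- If W ⊆ ℝ⁸ is a linear subspace on which the Cayley form vanishes identically, i.e. Φ₀(w₁,w₂,w₃,w₄) = 0 for all w₁, w₂, w₃, w₄ ∈ W, then the dimension of W is at most 4. -/

import Mathlib

open scoped RealInnerProductSpace

noncomputable section

abbrev E8 := EuclideanSpace ℝ (Fin 8)

/-- The 4-form `dx_{ijkl}` on `ℝ⁸`. -/
def dx4 (i j k l : Fin 8) (v : Fin 4 → E8) : ℝ :=
  Matrix.det (Matrix.of fun r s : Fin 4 => v s (![i, j, k, l] r))

/-- The Cayley 4-form `Φ₀` on `ℝ⁸`. -/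
def Phi0 (v : Fin 4 → E8) : ℝ :=
  dx4 0 1 2 3 v + dx4 0 1 4 5 v - dx4 0 1 6 7 v + dx4 0 2 4 6 v + dx4 0 2 5 7 v
    + dx4 0 3 4 7 v - dx4 0 3 5 6 v - dx4 1 2 4 7 v + dx4 1 2 5 6 v + dx4 1 3 4 6 v
    + dx4 1 3 5 7 v - dx4 2 3 4 5 v + dx4 2 3 6 7 v + dx4 4 5 6 7 v

/-- The Cayley form applied to four vectors. -/
def Phi (a b c d : E8) : ℝ := Phi0 ![a, b, c, d]

/-- The `i`-th standard basis vector of `ℝ⁸`. -/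
def stdB (i : Fin 8) : E8 := EuclideanSpace.single i 1

/-- The triple cross product: the unique vector with `⟪x, u×v×w⟫ = Φ₀(x,u,v,w)`
for all `x`. -/
def crossTriple (u v w : E8) : E8 :=
  (EuclideanSpace.equiv (Fin 8) ℝ).symm fun i => Phi (stdB i) u v w

/-- A 4-dimensional subspace of `ℝ⁸` is Cayley if it has an orthonormal basis on which
`Φ₀` takes the value `1`. -/
def IsCayley (V : Submodule ℝ E8) : Prop :=
  Module.finrank ℝ V = 4 ∧
    ∃ v : Fin 4 → E8, (∀ i, v i ∈ V) ∧ Orthonormal ℝ v ∧ Phi0 v = 1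

/-- The octonion product on `ℝ⁸` with unit `e₀` determined by `Φ₀`. -/
def octMul (x y : E8) : E8 :=
  !₂[x 0 * y 0 - x 1 * y 1 - x 2 * y 2 - x 3 * y 3
      - x 4 * y 4 - x 5 * y 5 - x 6 * y 6 - x 7 * y 7,
    x 0 * y 1 + x 1 * y 0 + x 2 * y 3 - x 3 * y 2
      + x 4 * y 5 - x 5 * y 4 - x 6 * y 7 + x 7 * y 6,
    x 0 * y 2 - x 1 * y 3 + x 2 * y 0 + x 3 * y 1
      + x 4 * y 6 + x 5 * y 7 - x 6 * y 4 - x 7 * y 5,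
    x 0 * y 3 + x 1 * y 2 - x 2 * y 1 + x 3 * y 0
      + x 4 * y 7 - x 5 * y 6 + x 6 * y 5 - x 7 * y 4,
    x 0 * y 4 - x 1 * y 5 - x 2 * y 6 - x 3 * y 7
      + x 4 * y 0 + x 5 * y 1 + x 6 * y 2 + x 7 * y 3,
    x 0 * y 5 + x 1 * y 4 - x 2 * y 7 + x 3 * y 6
      - x 4 * y 1 + x 5 * y 0 - x 6 * y 3 + x 7 * y 2,
    x 0 * y 6 + x 1 * y 7 + x 2 * y 4 - x 3 * y 5
      - x 4 * y 2 + x 5 * y 3 + x 6 * y 0 - x 7 * y 1,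
    x 0 * y 7 - x 1 * y 6 + x 2 * y 5 + x 3 * y 4
      - x 4 * y 3 - x 5 * y 2 + x 6 * y 1 + x 7 * y 0]

/-- Octonion conjugation. -/
def octConj (x : E8) : E8 :=
  !₂[x 0, -x 1, -x 2, -x 3, -x 4, -x 5, -x 6, -x 7]

lemma inner_octMul_octMul (x y z : E8) :
    ⟪octMul x y, octMul x z⟫ = ⟪x, x⟫ * ⟪y, z⟫ := by
  simp only [octMul, PiLp.inner_apply, RCLike.inner_apply, conj_trivial, Fin.sum_univ_eight]
  simp
  ring

lemma inner_octConj_octConj (x y : E8) : ⟪octConj x, octConj y⟫ = ⟪x, y⟫ := by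
  simp [octConj, PiLp.inner_apply, Fin.sum_univ_eight]

lemma dx4_eq (i j k l : Fin 8) (a b c d : E8) :
    dx4 i j k l ![a, b, c, d] =
      (a i * b j - a j * b i) * (c k * d l - c l * d k)
      - (a i * b k - a k * b i) * (c j * d l - c l * d j)
      + (a i * b l - a l * b i) * (c j * d k - c k * d j)
      + (a j * b k - a k * b j) * (c i * d l - c l * d i)
      - (a j * b l - a l * b j) * (c i * d k - c k * d i)
      + (a k * b l - a l * b k) * (c i * d j - c j * d i) := by
  simp [dx4, Matrix.det_succ_row_zero, Fin.sum_univ_succ, Fin.succAbove]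
  ring

lemma Phi_rotate (a b c d : E8) : Phi a b c d = Phi a c d b := by
  simp only [Phi, Phi0, dx4_eq]
  ring

lemma Phi_swap (a b c d : E8) : Phi a b c d = -Phi a c b d := by
  simp only [Phi, Phi0, dx4_eq]
  ring

lemma crossTriple_apply (u v w : E8) (i : Fin 8) : crossTriple u v w i = Phi (stdB i) u v w := rfl

lemma crossTriple_rotate (u v w : E8) : crossTriple u v w = crossTriple v w u := by
  ext i
  exact Phi_rotate _ _ _ _

lemma crossTriple_swap (u v w : E8) : crossTriple u v w = -crossTriple v u w := by
  ext i
  exact Phi_swap _ _ _ _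

lemma crossTriple_swap_right (u v w : E8) : crossTriple u v w = -crossTriple u w v := by
  rw [crossTriple_rotate u v w, crossTriple_swap v w u, crossTriple_rotate u w v]

lemma inner_crossTriple (x u v w : E8) : ⟪x, crossTriple u v w⟫ = Phi x u v w := by
  simp only [PiLp.inner_apply, RCLike.inner_apply, conj_trivial, Fin.sum_univ_eight,
    crossTriple_apply, Phi, Phi0, dx4_eq, stdB]
  simp
  ring

lemma crossTriple_eq (u v w : E8) :
    crossTriple u v w =
      octMul u (octMul (octConj v) w) - ⟪u, v⟫ • w + ⟪u, w⟫ • v - ⟪v, w⟫ • u := by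
  ext i
  simp only [crossTriple_apply, Phi, Phi0, dx4_eq, stdB, octMul, octConj, PiLp.inner_apply,
    RCLike.inner_apply, conj_trivial, Fin.sum_univ_eight]
  fin_cases i <;> simp <;> ring

/-- For orthonormal `u, v`, the map `w ↦ u × v × w` is isometric on the orthogonal
complement of `u` and `v`. -/
lemma inner_crossTriple_crossTriple {u v w w' : E8} (hu : ⟪u, u⟫ = 1) (hv : ⟪v, v⟫ = 1)
    (huv : ⟪u, v⟫ = 0) (huw : ⟪u, w⟫ = 0) (hvw : ⟪v, w⟫ = 0)
    (huw' : ⟪u, w'⟫ = 0) (hvw' : ⟪v, w'⟫ = 0) :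
    ⟪crossTriple u v w, crossTriple u v w'⟫ = ⟪w, w'⟫ := by
  simp only [crossTriple_eq, huv, huw, hvw, huw', hvw', zero_smul, sub_zero, add_zero,
    inner_octMul_octMul, inner_octConj_octConj, hu, hv, one_mul]

/-- The four triple cross products of an orthonormal quadruple are orthonormal. -/
lemma orthonormal_crossTriple {e : Fin 4 → E8} (he : Orthonormal ℝ e) :
    Orthonormal ℝ ![crossTriple (e 0) (e 1) (e 2), crossTriple (e 0) (e 1) (e 3),
      crossTriple (e 0) (e 2) (e 3), crossTriple (e 1) (e 2) (e 3)] := by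
  rw [orthonormal_iff_ite] at he
  have key (i j k l : Fin 4) (hij : i ≠ j) (hik : i ≠ k) (hjk : j ≠ k) (hil : i ≠ l)
      (hjl : j ≠ l) : ⟪crossTriple (e i) (e j) (e k), crossTriple (e i) (e j) (e l)⟫ =
        if k = l then 1 else 0 := by
    rw [inner_crossTriple_crossTriple] <;> simp only [if_true, if_false, *]
  have h01 := key 0 1 2 3 (by decide) (by decide) (by decide) (by decide) (by decide)
  have h02 := key 0 2 1 3 (by decide) (by decide) (by decide) (by decide) (by decide)
  have h03 := key 1 2 0 3 (by decide) (by decide) (by decide) (by decide) (by decide)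
  have h12 := key 0 3 1 2 (by decide) (by decide) (by decide) (by decide) (by decide)
  have h13 := key 1 3 0 2 (by decide) (by decide) (by decide) (by decide) (by decide)
  have h23 := key 2 3 0 1 (by decide) (by decide) (by decide) (by decide) (by decide)
  have h00 := key 0 1 2 2 (by decide) (by decide) (by decide) (by decide) (by decide)
  have h11 := key 0 1 3 3 (by decide) (by decide) (by decide) (by decide) (by decide)
  have h22 := key 0 2 3 3 (by decide) (by decide) (by decide) (by decide) (by decide)
  have h33 := key 1 2 3 3 (by decide) (by decide) (by decide) (by decide) (by decide)
  rw [crossTriple_swap_right (e 0) (e 2) (e 1)] at h02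
  rw [← crossTriple_rotate (e 0) (e 1) (e 2)] at h03
  rw [crossTriple_swap_right (e 0) (e 3) (e 1), crossTriple_swap_right (e 0) (e 3) (e 2)] at h12
  rw [← crossTriple_rotate (e 0) (e 1) (e 3), crossTriple_swap_right (e 1) (e 3) (e 2)] at h13
  rw [← crossTriple_rotate (e 0) (e 2) (e 3), ← crossTriple_rotate (e 1) (e 2) (e 3)] at h23
  simp only [inner_neg_left, inner_neg_right, neg_neg, neg_eq_zero, Fin.reduceEq, if_false,
    if_true] at h00 h01 h02 h03 h11 h12 h13 h22 h23 h33
  rw [orthonormal_iff_ite]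
  intro i j
  fin_cases i <;> fin_cases j <;>
    simp only [Fin.reduceFinMk, Fin.zero_eta, Fin.mk_one, Matrix.cons_val, Fin.reduceEq,
      if_false, if_true] <;>
    first
      | simp only [h00, h01, h02, h03, h11, h12, h13, h22, h23, h33]
      | rw [real_inner_comm]; simp only [h01, h02, h03, h12, h13, h23]

/-- A subspace of `ℝ⁸` on which the Cayley form vanishes identically has dimension at
most `4`. -/
theorem dim_le_four_of_phi_vanishes (W : Submodule ℝ E8)
    (h : ∀ w₁ w₂ w₃ w₄ : E8, w₁ ∈ W → w₂ ∈ W → w₃ ∈ W → w₄ ∈ W →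
      Phi w₁ w₂ w₃ w₄ = 0) :
    Module.finrank ℝ W ≤ 4 := by
  by_contra! hW
  let b := stdOrthonormalBasis ℝ W
  let e : Fin 4 → E8 := fun i => b (Fin.castLE hW.le i)
  have heW (i : Fin 4) : e i ∈ W := (b _).2
  have he : Orthonormal ℝ e :=
    (b.orthonormal.comp _ (Fin.castLE_injective hW.le)).comp_linearIsometry W.subtypeₗᵢ
  have hmem {u v w : E8} (hu : u ∈ W) (hv : v ∈ W) (hw : w ∈ W) : crossTriple u v w ∈ Wᗮ := by
    rw [Submodule.mem_orthogonal]
    intro x hx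
    rw [inner_crossTriple]
    exact h x u v w hx hu hv hw
  have hf := (orthonormal_crossTriple he).linearIndependent
  have hspan : 4 ≤ Module.finrank ℝ Wᗮ := by
    rw [← Fintype.card_fin 4, ← finrank_span_eq_card hf]
    refine Submodule.finrank_mono (Submodule.span_le.2 ?_)
    rintro _ ⟨i, rfl⟩
    fin_cases i <;> exact hmem (heW _) (heW _) (heW _)
  have hsum := W.finrank_add_finrank_orthogonal
  rw [finrank_euclideanSpace_fin] at hsum
  omega

end
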